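/- The operator D̂_λ is bijective if and only if 𝐃 − λ·id : V₀ → V_r is bijective, and in that case for every w ∈ V_r one has D̂_λ^{−1}(w, 0, …, 0) = (C₀ (𝐃 − λ·id)^{−1} w, C₁ (𝐃 − λ·id)^{−1} w, …, C_{r−1} (𝐃 − λ·id)^{−1} w); in particular the V₀-component of D̂_λ^{−1}(w, 0, …, 0) equals (𝐃 − λ·id)^{−1} w, i.e. the resolvent (𝐃 − λ·id)^{−1} is the (1,1)-block of D̂_λ^{−1}. -/

import Mathlib

namespace RelZeta

variable (𝕜 : Type*) [Field 𝕜] (r : ℕ) (V : ℕ → Type*)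
  [∀ i, AddCommGroup (V i)] [∀ i, Module 𝕜 (V i)]
  (D : ∀ i : ℕ, V i →ₗ[𝕜] V (i + 1))

/-- `Comp 𝕜 V D i = Dᵢ₋₁ ∘ ⋯ ∘ D₀ : V₀ → Vᵢ` (with `Comp 0 = id`);
`Comp 𝕜 V D r` is the `r`-th order operator `𝐃`. -/
def Comp : ∀ i : ℕ, V 0 →ₗ[𝕜] V i
  | 0 => LinearMap.id
  | (i + 1) => (D i).comp (Comp i)

/-- The doubled-up first-order operator `D̂ : V₀ ⊕ ⋯ ⊕ V_{r-1} → V_r ⊕ ⋯ ⊕ V₁`.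
The component of index `j : Fin r` of the codomain is `V (j+1)`; for `j+1 = r` it is
`D_{r-1} s_{r-1}`, and for `1 ≤ j+1 ≤ r-1` it is `D_j s_j − s_{j+1}`
(i.e. in the paper's indexing, the `V_j`-component is `D_{j-1} s_{j-1} − s_j`). -/
def Dhat : (∀ i : Fin r, V i) →ₗ[𝕜] (∀ j : Fin r, V ((j : ℕ) + 1)) where
  toFun s := fun j =>
    D j (s j) - (if h : (j : ℕ) + 1 < r then s ⟨(j : ℕ) + 1, h⟩ else 0)
  map_add' s t := by
    funext j
    by_cases h : (j : ℕ) + 1 < r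
    · simp [h]; abel
    · simp [h]
  map_smul' c s := by
    funext j
    by_cases h : (j : ℕ) + 1 < r <;> simp [h, smul_sub]

/-- Cast along an equality of indices. -/
def vcast {a b : ℕ} (h : a = b) : V a ≃ₗ[𝕜] V b := by
  subst h; exact LinearEquiv.refl 𝕜 (V a)

/-- The inclusion `w ↦ (w, 0, …, 0)` of `V_r` into `V_r ⊕ V_{r-1} ⊕ ⋯ ⊕ V₁`
as the top component (the component of index `j = r-1`, valued in `V r`). -/
def TopIncl (hr : 0 < r) : V r →ₗ[𝕜] ∀ j : Fin r, V ((j : ℕ) + 1) :=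
  (LinearMap.single 𝕜 (fun j : Fin r => V ((j : ℕ) + 1)) ⟨r - 1, by omega⟩).comp
    (vcast 𝕜 V (by omega : r = (r - 1) + 1)).toLinearMap

/-- Under the identification `e : V_r ≃ V₀`, the operator `𝐃 − λ·id : V₀ → V_r`. -/
def Dlam (e : V r ≃ₗ[𝕜] V 0) (lam : 𝕜) : V 0 →ₗ[𝕜] V r :=
  Comp 𝕜 V D r - lam • (e.symm.toLinearMap)

/-- The doubled-up operator `D̂_λ : V₀ ⊕ ⋯ ⊕ V_{r-1} → V_r ⊕ ⋯ ⊕ V₁`, whose component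
in `V_r` is `D_{r-1} s_{r-1} − λ s₀` (using the identification `e : V_r ≃ V₀`) and whose
component in `V_j`, `1 ≤ j ≤ r-1`, is `D_{j-1} s_{j-1} − s_j`. -/
def Dhatlam (hr : 0 < r) (e : V r ≃ₗ[𝕜] V 0) (lam : 𝕜) :
    (∀ i : Fin r, V i) →ₗ[𝕜] ∀ j : Fin r, V ((j : ℕ) + 1) :=
  Dhat 𝕜 r V D -
    lam • ((TopIncl 𝕜 r V hr).comp
      (e.symm.toLinearMap.comp (LinearMap.proj (⟨0, hr⟩ : Fin r))))

section

variable {r V D}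

theorem topIncl_apply_of_lt (hr : 0 < r) (w : V r) (j : Fin r) (h : (j : ℕ) + 1 < r) :
    TopIncl 𝕜 r V hr w j = 0 := by
  have hj : j ≠ ⟨r - 1, by omega⟩ := by
    intro hj
    have := congrArg Fin.val hj
    simp only at this
    omega
  simp [TopIncl, Pi.single_eq_of_ne hj]

theorem topIncl_apply_last {n : ℕ} (w : V (n + 1)) :
    TopIncl 𝕜 (n + 1) V n.succ_pos w (Fin.last n) = w :=
  Pi.single_eq_same (M := fun j : Fin (n + 1) => V ((j : ℕ) + 1)) (Fin.last n) w

theorem topIncl_injective (hr : 0 < r) : Function.Injective (TopIncl 𝕜 r V hr) := by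
  obtain ⟨n, rfl⟩ : ∃ n, r = n + 1 := ⟨r - 1, by omega⟩
  intro w w' h
  rw [← topIncl_apply_last 𝕜 w, h, topIncl_apply_last]

theorem dhatlam_apply_of_lt (hr : 0 < r) (e : V r ≃ₗ[𝕜] V 0) (lam : 𝕜)
    (s : ∀ i : Fin r, V i) (j : Fin r) (h : (j : ℕ) + 1 < r) :
    Dhatlam 𝕜 r V D hr e lam s j = D j (s j) - s ⟨(j : ℕ) + 1, h⟩ := by
  simp [Dhatlam, Dhat, h, topIncl_apply_of_lt 𝕜 hr _ j h]

/-- An element of the codomain whose components below the top one vanish is in the image of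
`TopIncl`. -/
theorem exists_topIncl_eq (hr : 0 < r) (y : ∀ j : Fin r, V ((j : ℕ) + 1))
    (hy : ∀ j : Fin r, (j : ℕ) + 1 < r → y j = 0) : ∃ w, TopIncl 𝕜 r V hr w = y := by
  obtain ⟨n, rfl⟩ : ∃ n, r = n + 1 := ⟨r - 1, by omega⟩
  refine ⟨y (Fin.last n), ?_⟩
  funext j
  by_cases h : (j : ℕ) + 1 < n + 1
  · rw [topIncl_apply_of_lt 𝕜 hr _ j h, hy j h]
  · obtain rfl : j = Fin.last n := Fin.ext (by have := j.isLt; simp; omega)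
    exact topIncl_apply_last 𝕜 _

theorem dhatlam_comp (hr : 0 < r) (e : V r ≃ₗ[𝕜] V 0) (lam : 𝕜) (x : V 0) :
    Dhatlam 𝕜 r V D hr e lam (fun i => Comp 𝕜 V D i x) =
      TopIncl 𝕜 r V hr (Dlam 𝕜 r V D e lam x) := by
  obtain ⟨n, rfl⟩ : ∃ n, r = n + 1 := ⟨r - 1, by omega⟩
  funext j
  by_cases h : (j : ℕ) + 1 < n + 1
  · rw [topIncl_apply_of_lt 𝕜 hr _ j h, dhatlam_apply_of_lt 𝕜 hr e lam _ j h]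
    exact sub_self _
  · obtain rfl : j = Fin.last n := Fin.ext (by have := j.isLt; simp; omega)
    rw [topIncl_apply_last]
    simp [Dhatlam, Dhat, Dlam, topIncl_apply_last, Comp]
    rfl

theorem eq_comp_of_dhatlam_eq_topIncl (hr : 0 < r) (e : V r ≃ₗ[𝕜] V 0) (lam : 𝕜)
    {s : ∀ i : Fin r, V i} {w : V r}
    (h : Dhatlam 𝕜 r V D hr e lam s = TopIncl 𝕜 r V hr w) :
    s = fun i : Fin r => Comp 𝕜 V D i (s ⟨0, hr⟩) := by
  have key : ∀ (i : ℕ) (hi : i < r), s ⟨i, hi⟩ = Comp 𝕜 V D i (s ⟨0, hr⟩) := by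
    intro i
    induction i with
    | zero => intro _; rfl
    | succ i ih =>
      intro hi
      have hj := congrFun h ⟨i, by omega⟩
      rw [dhatlam_apply_of_lt 𝕜 hr e lam s ⟨i, by omega⟩ hi,
        topIncl_apply_of_lt 𝕜 hr w ⟨i, by omega⟩ hi, sub_eq_zero] at hj
      rw [← hj, ih (by omega)]
      rfl
  funext i
  exact key i i.isLt

theorem dlam_eq_of_dhatlam_eq_topIncl (hr : 0 < r) (e : V r ≃ₗ[𝕜] V 0) (lam : 𝕜)
    {s : ∀ i : Fin r, V i} {w : V r}
    (h : Dhatlam 𝕜 r V D hr e lam s = TopIncl 𝕜 r V hr w) :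
    Dlam 𝕜 r V D e lam (s ⟨0, hr⟩) = w := by
  apply topIncl_injective 𝕜 hr
  rw [← dhatlam_comp, ← eq_comp_of_dhatlam_eq_topIncl 𝕜 hr e lam h, h]

/-- The solution with zero initial value of the recursion `s_{i+1} = Dᵢ sᵢ - yᵢ`. -/
def recSol (D : ∀ i : ℕ, V i →ₗ[𝕜] V (i + 1)) (y : ∀ j : Fin r, V ((j : ℕ) + 1)) :
    ∀ i : ℕ, V i
  | 0 => 0
  | i + 1 => D i (recSol D y i) - if h : i < r then y ⟨i, h⟩ else 0

theorem exists_dhatlam_sub_eq_topIncl (hr : 0 < r) (e : V r ≃ₗ[𝕜] V 0) (lam : 𝕜)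
    (y : ∀ j : Fin r, V ((j : ℕ) + 1)) :
    ∃ s w, TopIncl 𝕜 r V hr w = Dhatlam 𝕜 r V D hr e lam s - y := by
  refine ⟨fun i => recSol 𝕜 D y i, exists_topIncl_eq 𝕜 hr _ fun j h => ?_⟩
  rw [Pi.sub_apply, dhatlam_apply_of_lt 𝕜 hr e lam _ j h]
  simp [recSol]

theorem bijective_dhatlam_iff (hr : 0 < r) (e : V r ≃ₗ[𝕜] V 0) (lam : 𝕜) :
    Function.Bijective (Dhatlam 𝕜 r V D hr e lam) ↔
      Function.Bijective (Dlam 𝕜 r V D e lam) := by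
  constructor
  · rintro ⟨hinj, hsurj⟩
    refine ⟨fun x x' h => ?_, fun w => ?_⟩
    · have := hinj ((dhatlam_comp 𝕜 hr e lam x).trans
        ((congrArg _ h).trans (dhatlam_comp 𝕜 hr e lam x').symm))
      exact congrFun this ⟨0, hr⟩
    · obtain ⟨s, hs⟩ := hsurj (TopIncl 𝕜 r V hr w)
      exact ⟨_, dlam_eq_of_dhatlam_eq_topIncl 𝕜 hr e lam hs⟩
  · rintro ⟨hinj, hsurj⟩
    refine ⟨(injective_iff_map_eq_zero _).2 fun s hs => ?_, fun y => ?_⟩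
    · have hs' : Dhatlam 𝕜 r V D hr e lam s = TopIncl 𝕜 r V hr 0 := by rw [hs, map_zero]
      have h0 : s ⟨0, hr⟩ = 0 :=
        hinj ((dlam_eq_of_dhatlam_eq_topIncl 𝕜 hr e lam hs').trans (map_zero _).symm)
      rw [eq_comp_of_dhatlam_eq_topIncl 𝕜 hr e lam hs', h0]
      funext i
      exact map_zero _
    · obtain ⟨s, w, hw⟩ := exists_dhatlam_sub_eq_topIncl 𝕜 (D := D) hr e lam y
      obtain ⟨x, rfl⟩ := hsurj w
      refine ⟨s - fun i : Fin r => Comp 𝕜 V D i x, ?_⟩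
      rw [map_sub, dhatlam_comp, hw, sub_sub_cancel]

end

/-- `D̂_λ` is bijective iff `𝐃 − λ·id : V₀ → V_r` is bijective, and in that case
`D̂_λ⁻¹(w, 0, …, 0) = (C₀ (𝐃 − λ)⁻¹ w, …, C_{r-1} (𝐃 − λ)⁻¹ w)` for every `w ∈ V_r`;
in particular the `V₀`-component of `D̂_λ⁻¹(w, 0, …, 0)` is `(𝐃 − λ·id)⁻¹ w`, i.e. the
resolvent `(𝐃 − λ·id)⁻¹` is the `(1,1)`-block of `D̂_λ⁻¹`. -/
theorem statement7 (hr : 0 < r) (e : V r ≃ₗ[𝕜] V 0) (lam : 𝕜) :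
    (Function.Bijective (Dhatlam 𝕜 r V D hr e lam) ↔
      Function.Bijective (Dlam 𝕜 r V D e lam)) ∧
    ∀ (h1 : Function.Bijective (Dhatlam 𝕜 r V D hr e lam))
      (h2 : Function.Bijective (Dlam 𝕜 r V D e lam)) (w : V r),
      (∀ i : Fin r,
        (LinearEquiv.ofBijective (Dhatlam 𝕜 r V D hr e lam) h1).symm
            (TopIncl 𝕜 r V hr w) i =
          Comp 𝕜 V D i ((LinearEquiv.ofBijective (Dlam 𝕜 r V D e lam) h2).symm w)) ∧
      (LinearEquiv.ofBijective (Dhatlam 𝕜 r V D hr e lam) h1).symm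
          (TopIncl 𝕜 r V hr w) ⟨0, hr⟩ =
        (LinearEquiv.ofBijective (Dlam 𝕜 r V D e lam) h2).symm w := by
  refine ⟨bijective_dhatlam_iff 𝕜 hr e lam, fun h1 h2 w => ?_⟩
  have key : (LinearEquiv.ofBijective (Dhatlam 𝕜 r V D hr e lam) h1).symm
      (TopIncl 𝕜 r V hr w) = fun i : Fin r =>
        Comp 𝕜 V D i ((LinearEquiv.ofBijective (Dlam 𝕜 r V D e lam) h2).symm w) := by
    rw [LinearEquiv.symm_apply_eq, LinearEquiv.ofBijective_apply, dhatlam_comp]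
    congr 1
    exact ((LinearEquiv.ofBijective (Dlam 𝕜 r V D e lam) h2).apply_symm_apply w).symm
  exact ⟨fun i => congrFun key i, congrFun key ⟨0, hr⟩⟩

end RelZeta
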